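/- (Canonical double-max duality.) If (w̄,σ̄) is a stationary point of Ξ with σ̄ ∈ S⁻ (i.e. G(σ̄) is negative definite), then w̄ is a local maximizer of Π_p on ℝⁿ if and only if σ̄ is a local maximizer of Π_d on S⁻, and in that case Π_p(w̄) = Π_d(σ̄). -/

import Mathlib

open Matrix

/-- `G σ = A + Σ σ_i B_i`. -/
noncomputable def G {n p : ℕ} (A : Matrix (Fin n) (Fin n) ℝ)
    (B : Fin p → Matrix (Fin n) (Fin n) ℝ) (σ : Fin p → ℝ) : Matrix (Fin n) (Fin n) ℝ :=
  A + ∑ i, σ i • B i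

/-- The total complementary energy
`Ξ(w,σ) = (1/2) wᵀ G(σ) w − (1/2) σᵀ K σ − ℓᵀ σ − fᵀ w − c`. -/
noncomputable def Xi {n p : ℕ} (A : Matrix (Fin n) (Fin n) ℝ)
    (B : Fin p → Matrix (Fin n) (Fin n) ℝ) (K : Matrix (Fin p) (Fin p) ℝ)
    (f : Fin n → ℝ) (ℓ : Fin p → ℝ) (c : ℝ) (w : Fin n → ℝ) (σ : Fin p → ℝ) : ℝ :=
  (1/2) * (w ⬝ᵥ (G A B σ).mulVec w) - (1/2) * (σ ⬝ᵥ K.mulVec σ) - ℓ ⬝ᵥ σ - f ⬝ᵥ w - c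

/-- `h(w)_i = (1/2) wᵀ B_i w`. -/
noncomputable def hq {n p : ℕ} (B : Fin p → Matrix (Fin n) (Fin n) ℝ)
    (w : Fin n → ℝ) : Fin p → ℝ :=
  fun i => (1/2) * (w ⬝ᵥ (B i).mulVec w)

/-- The total potential `Π_p(w) = sup_{σ} Ξ(w,σ)`. -/
noncomputable def Pip {n p : ℕ} (A : Matrix (Fin n) (Fin n) ℝ)
    (B : Fin p → Matrix (Fin n) (Fin n) ℝ) (K : Matrix (Fin p) (Fin p) ℝ)
    (f : Fin n → ℝ) (ℓ : Fin p → ℝ) (c : ℝ) (w : Fin n → ℝ) : ℝ :=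
  ⨆ σ : Fin p → ℝ, Xi A B K f ℓ c w σ

/-- The canonical dual function
`Π_d(σ) = −(1/2) fᵀ G(σ)⁻¹ f − (1/2) σᵀ K σ − ℓᵀ σ − c`. -/
noncomputable def Pid {n p : ℕ} (A : Matrix (Fin n) (Fin n) ℝ)
    (B : Fin p → Matrix (Fin n) (Fin n) ℝ) (K : Matrix (Fin p) (Fin p) ℝ)
    (f : Fin n → ℝ) (ℓ : Fin p → ℝ) (c : ℝ) (σ : Fin p → ℝ) : ℝ :=
  -(1/2) * (f ⬝ᵥ (G A B σ)⁻¹.mulVec f) - (1/2) * (σ ⬝ᵥ K.mulVec σ) - ℓ ⬝ᵥ σ - c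

open Topology Filter

theorem Matrix.IsSymm.add_dotProduct_mulVec_add {m : Type*} [Fintype m] {M : Matrix m m ℝ}
    (hM : M.IsSymm) (x d : m → ℝ) :
    (x + d) ⬝ᵥ M *ᵥ (x + d) = x ⬝ᵥ M *ᵥ x + 2 * ((M *ᵥ x) ⬝ᵥ d) + d ⬝ᵥ M *ᵥ d := by
  have h : x ⬝ᵥ M *ᵥ d = (M *ᵥ x) ⬝ᵥ d := by
    rw [dotProduct_mulVec, ← mulVec_transpose, hM.eq]
  rw [mulVec_add, add_dotProduct, dotProduct_add, dotProduct_add, h,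
    dotProduct_comm d (M *ᵥ x)]
  ring

/-- Positive definiteness is an open condition among symmetric matrices. -/
theorem Matrix.PosDef.eventually_of_continuous {X : Type*} [TopologicalSpace X] {n : ℕ}
    {M : X → Matrix (Fin n) (Fin n) ℝ} {x₀ : X} (hM : Continuous M)
    (hsymm : ∀ x, (M x).IsSymm) (h₀ : (M x₀).PosDef) : ∀ᶠ x in 𝓝 x₀, (M x).PosDef := by
  have key : ∀ᶠ x in 𝓝 x₀, ∀ v ∈ Metric.sphere (0 : Fin n → ℝ) 1, 0 < v ⬝ᵥ M x *ᵥ v := by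
    refine (isCompact_sphere _ _).eventually_forall_of_forall_eventually fun v hv => ?_
    have hcont : Continuous fun z : X × (Fin n → ℝ) => z.2 ⬝ᵥ M z.1 *ᵥ z.2 :=
      continuous_snd.dotProduct ((hM.comp continuous_fst).matrix_mulVec continuous_snd)
    refine hcont.continuousAt.eventually (lt_mem_nhds ?_)
    have hv0 : v ≠ 0 := by
      rintro rfl
      simp at hv
    simpa using h₀.dotProduct_mulVec_pos hv0
  filter_upwards [key] with x hx
  refine .of_dotProduct_mulVec_pos (by simpa [IsHermitian, IsSymm] using hsymm x) fun v hv => ?_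
  have hn : 0 < ‖v‖ := norm_pos_iff.2 hv
  have h := hx (‖v‖⁻¹ • v) (by simp [norm_smul, hn.ne'])
  rw [mulVec_smul, smul_dotProduct, dotProduct_smul, smul_eq_mul, smul_eq_mul] at h
  have hi := inv_pos.2 hn
  simpa using pos_of_mul_pos_right (pos_of_mul_pos_right h hi.le) hi.le

section Duality

variable {n p : ℕ} {A : Matrix (Fin n) (Fin n) ℝ} {B : Fin p → Matrix (Fin n) (Fin n) ℝ}
  {K : Matrix (Fin p) (Fin p) ℝ} {f : Fin n → ℝ} {ℓ : Fin p → ℝ} {c : ℝ}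

theorem continuous_G : Continuous (G A B) := by
  unfold G
  fun_prop

theorem isSymm_G (hA : A.IsSymm) (hB : ∀ i, (B i).IsSymm) (σ : Fin p → ℝ) :
    (G A B σ).IsSymm := by
  simp only [G, IsSymm, transpose_add, transpose_sum, transpose_smul, hA.eq, (hB _).eq]

theorem continuous_hq : Continuous (hq B) :=
  continuous_pi fun _ => continuous_const.mul
    (continuous_id.dotProduct (continuous_const.matrix_mulVec continuous_id))

theorem half_dotProduct_G_mulVec (w : Fin n → ℝ) (σ : Fin p → ℝ) :
    (1 / 2) * (w ⬝ᵥ G A B σ *ᵥ w) = (1 / 2) * (w ⬝ᵥ A *ᵥ w) + hq B w ⬝ᵥ σ := by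
  have h : (∑ i, σ i • B i) *ᵥ w = ∑ i, σ i • (B i *ᵥ w) := by
    rw [sum_mulVec]
    simp only [smul_mulVec]
  rw [G, add_mulVec, dotProduct_add, h, dotProduct_sum, mul_add, Finset.mul_sum]
  congr 1
  refine Finset.sum_congr rfl fun i _ => ?_
  rw [dotProduct_smul, smul_eq_mul, hq]
  ring

theorem Xi_le_of_mulVec_eq_sub (hK : K.PosDef) {w : Fin n → ℝ} {σ₀ : Fin p → ℝ}
    (h₀ : K *ᵥ σ₀ = hq B w - ℓ) (σ : Fin p → ℝ) :
    Xi A B K f ℓ c w σ ≤ Xi A B K f ℓ c w σ₀ := by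
  have hsymm : K.IsSymm := by simpa [IsHermitian, IsSymm] using hK.isHermitian
  obtain ⟨d, rfl⟩ : ∃ d, σ = σ₀ + d := ⟨σ - σ₀, by simp⟩
  have hd : 0 ≤ d ⬝ᵥ K *ᵥ d := by simpa using hK.posSemidef.dotProduct_mulVec_nonneg d
  simp only [Xi, half_dotProduct_G_mulVec, hsymm.add_dotProduct_mulVec_add, h₀,
    sub_dotProduct, dotProduct_add]
  linarith

theorem bddAbove_range_Xi (hK : K.PosDef) (w : Fin n → ℝ) :
    BddAbove (Set.range (Xi A B K f ℓ c w)) := by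
  have hdet : IsUnit K.det := (isUnit_iff_isUnit_det K).1 hK.isUnit
  refine ⟨Xi A B K f ℓ c w (K⁻¹ *ᵥ (hq B w - ℓ)), ?_⟩
  rintro _ ⟨σ, rfl⟩
  refine Xi_le_of_mulVec_eq_sub hK ?_ σ
  rw [mulVec_mulVec, mul_nonsing_inv _ hdet, one_mulVec]

theorem Xi_le_Pip (hK : K.PosDef) (w : Fin n → ℝ) (σ : Fin p → ℝ) :
    Xi A B K f ℓ c w σ ≤ Pip A B K f ℓ c w :=
  le_ciSup (bddAbove_range_Xi hK w) σ

theorem Pip_eq_Xi (hK : K.PosDef) {w : Fin n → ℝ} {σ₀ : Fin p → ℝ}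
    (h₀ : K *ᵥ σ₀ = hq B w - ℓ) : Pip A B K f ℓ c w = Xi A B K f ℓ c w σ₀ :=
  le_antisymm (ciSup_le (Xi_le_of_mulVec_eq_sub hK h₀)) (Xi_le_Pip hK w σ₀)

theorem Pid_eq_Xi {σ : Fin p → ℝ} (hdet : IsUnit (G A B σ).det) {w₀ : Fin n → ℝ}
    (h₀ : G A B σ *ᵥ w₀ = f) : Pid A B K f ℓ c σ = Xi A B K f ℓ c w₀ σ := by
  have hw : (G A B σ)⁻¹ *ᵥ f = w₀ := by
    rw [← h₀, mulVec_mulVec, nonsing_inv_mul _ hdet, one_mulVec]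
  rw [Pid, Xi, hw, h₀, dotProduct_comm w₀ f]
  ring

theorem isUnit_det_of_posDef_neg {M : Matrix (Fin n) (Fin n) ℝ} (h : (-M).PosDef) :
    IsUnit M.det :=
  (isUnit_iff_isUnit_det M).1 (by simpa using h.isUnit.neg)

theorem Xi_le_Pid {σ : Fin p → ℝ} (hG : (-(G A B σ)).PosDef) (w : Fin n → ℝ) :
    Xi A B K f ℓ c w σ ≤ Pid A B K f ℓ c σ := by
  have hdet := isUnit_det_of_posDef_neg hG
  have hsymm : (G A B σ).IsSymm := by
    have h : (-(G A B σ))ᵀ = -(G A B σ) := by simpa [IsHermitian] using hG.isHermitian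
    simpa [IsSymm] using h
  have h₀ : G A B σ *ᵥ ((G A B σ)⁻¹ *ᵥ f) = f := by
    rw [mulVec_mulVec, mul_nonsing_inv _ hdet, one_mulVec]
  rw [Pid_eq_Xi hdet h₀]
  set w₀ := (G A B σ)⁻¹ *ᵥ f
  obtain ⟨d, rfl⟩ : ∃ d, w = w₀ + d := ⟨w - w₀, by simp⟩
  have hd : 0 ≤ -(d ⬝ᵥ G A B σ *ᵥ d) := by
    simpa [neg_mulVec] using hG.posSemidef.dotProduct_mulVec_nonneg d
  simp only [Xi, hsymm.add_dotProduct_mulVec_add, h₀, dotProduct_add]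
  linarith

end Duality

/-- Canonical double-max duality: if `(w̄,σ̄)` is a stationary point of `Ξ` with
`G(σ̄)` negative definite, then `w̄` is a local maximizer of `Π_p` on `ℝⁿ` if and
only if `σ̄` is a local maximizer of `Π_d` on `S⁻`, and in that case
`Π_p(w̄) = Π_d(σ̄)`. -/
theorem stmt_15 (n p : ℕ) (hn : 0 < n) (hp : 0 < p)
    (A : Matrix (Fin n) (Fin n) ℝ) (hA : A.IsSymm)
    (B : Fin p → Matrix (Fin n) (Fin n) ℝ) (hB : ∀ i, (B i).IsSymm)
    (K : Matrix (Fin p) (Fin p) ℝ) (hK : K.PosDef)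
    (f : Fin n → ℝ) (ℓ : Fin p → ℝ) (c : ℝ)
    (wbar : Fin n → ℝ) (σbar : Fin p → ℝ)
    (hstat1 : (G A B σbar).mulVec wbar = f)
    (hstat2 : hq B wbar - K.mulVec σbar - ℓ = 0)
    (hGnd : (-(G A B σbar)).PosDef) :
    (IsLocalMax (Pip A B K f ℓ c) wbar ↔
        IsLocalMaxOn (Pid A B K f ℓ c) {σ : Fin p → ℝ | (-(G A B σ)).PosDef} σbar) ∧
      (IsLocalMax (Pip A B K f ℓ c) wbar →
        Pip A B K f ℓ c wbar = Pid A B K f ℓ c σbar) := by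
  have hstat2' : K *ᵥ σbar = hq B wbar - ℓ := by
    rw [sub_right_comm, sub_eq_zero] at hstat2
    exact hstat2.symm
  have hdetK : IsUnit K.det := (isUnit_iff_isUnit_det K).1 hK.isUnit
  have hdetG := isUnit_det_of_posDef_neg hGnd
  have heq : Pip A B K f ℓ c wbar = Pid A B K f ℓ c σbar := by
    rw [Pip_eq_Xi hK hstat2', Pid_eq_Xi hdetG hstat1]
  refine ⟨⟨fun hmax => ?_, fun hmax => ?_⟩, fun _ => heq⟩
  · have hcont : ContinuousAt (fun σ => (G A B σ)⁻¹ *ᵥ f) σbar := by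
      have hinv : ContinuousAt (fun σ => (G A B σ)⁻¹) σbar :=
        ContinuousAt.comp (f := G A B) (g := Inv.inv)
          (continuousAt_matrix_inv _ (by
            rw [Ring.inverse_eq_inv']
            exact continuousAt_inv₀ hdetG.ne_zero)) continuous_G.continuousAt
      exact ContinuousAt.comp (f := fun σ => (G A B σ)⁻¹) (g := fun M => M *ᵥ f)
        (continuous_id.matrix_mulVec continuous_const).continuousAt hinv
    have hwbar : (G A B σbar)⁻¹ *ᵥ f = wbar := by
      rw [← hstat1, mulVec_mulVec, nonsing_inv_mul _ hdetG, one_mulVec]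
    have hlim : Tendsto (fun σ => (G A B σ)⁻¹ *ᵥ f) (𝓝 σbar) (𝓝 wbar) := hwbar ▸ hcont.tendsto
    filter_upwards [nhdsWithin_le_nhds (hlim.eventually hmax), self_mem_nhdsWithin] with σ hσ hneg
    have hdet := isUnit_det_of_posDef_neg hneg
    have h₀ : G A B σ *ᵥ ((G A B σ)⁻¹ *ᵥ f) = f := by
      rw [mulVec_mulVec, mul_nonsing_inv _ hdet, one_mulVec]
    rw [← heq, Pid_eq_Xi hdet h₀]
    exact (Xi_le_Pip hK _ σ).trans hσ
  · have hσbar : K⁻¹ *ᵥ (hq B wbar - ℓ) = σbar := by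
      rw [← hstat2', mulVec_mulVec, nonsing_inv_mul _ hdetK, one_mulVec]
    have hlim : Tendsto (fun w => K⁻¹ *ᵥ (hq B w - ℓ)) (𝓝 wbar) (𝓝 σbar) := by
      have hcont : Continuous fun w => K⁻¹ *ᵥ (hq B w - ℓ) :=
        continuous_const.matrix_mulVec (continuous_hq.sub continuous_const)
      exact hσbar ▸ hcont.tendsto wbar
    have hneg : ∀ᶠ σ in 𝓝 σbar, (-(G A B σ)).PosDef :=
      PosDef.eventually_of_continuous continuous_G.neg
        (fun σ => by simpa [IsSymm] using (isSymm_G hA hB σ).eq) hGnd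
    filter_upwards [hlim.eventually (eventually_nhdsWithin_iff.1 hmax), hlim.eventually hneg]
      with w hw hwneg
    have h₀ : K *ᵥ (K⁻¹ *ᵥ (hq B w - ℓ)) = hq B w - ℓ := by
      rw [mulVec_mulVec, mul_nonsing_inv _ hdetK, one_mulVec]
    rw [heq, Pip_eq_Xi hK h₀]
    exact (Xi_le_Pid hwneg w).trans (hw hwneg)
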